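/- arXiv:2210.10063 — 2 statements merged into one kernel-verified Lean document; each statement's English description precedes it below -/
import Mathlib

section
/- Let p be a positive integer, Σ a symmetric invertible real p×p matrix with inverse Ω = Σ⁻¹ having entries ω_{jk}, and x, μ ∈ ℝ^p. For every index k ∈ P = {1,…,p}, the Shapley value coordinate φ_k(x, μ, Σ) := Σ_{S ⊆ P\{k}} (|S|!·(p − |S| − 1)!/p!)·(md²(x̂^{S∪{k}}) − md²(x̂^S)) equals (x_k − μ_k)·Σ_{j=1}^p (x_j − μ_j) ω_{jk}. -/
open Matrix Finset

/-- Squared Mahalanobis distance of `y` to `μ` with respect to `Sig`. -/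
noncomputable def md2 {p : ℕ} (Sig : Matrix (Fin p) (Fin p) ℝ) (μ y : Fin p → ℝ) : ℝ :=
  (y - μ) ⬝ᵥ (Sig⁻¹ *ᵥ (y - μ))

/-- The vector `x̂^S`, equal to `x` on coordinates in `S` and to `μ` elsewhere. -/
def xhat {p : ℕ} (x μ : Fin p → ℝ) (S : Finset (Fin p)) : Fin p → ℝ :=
  fun j => if j ∈ S then x j else μ j

theorem md2_xhat_aux {p : ℕ} (Sig : Matrix (Fin p) (Fin p) ℝ) (x μ : Fin p → ℝ)
    (S : Finset (Fin p)) :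
    md2 Sig μ (xhat x μ S) = ∑ i ∈ S, ∑ j ∈ S, (x i - μ i) * (x j - μ j) * Sig⁻¹ i j := by
  have h : ∀ i, (xhat x μ S - μ) i = if i ∈ S then x i - μ i else 0 := by
    intro i
    by_cases hi : i ∈ S <;> simp [xhat, hi]
  unfold md2
  simp only [dotProduct, mulVec, h, ite_mul, zero_mul, mul_ite, mul_zero]
  simp only [Finset.sum_ite_mem, Finset.univ_inter, Finset.mul_sum]
  refine Finset.sum_congr rfl fun i _ => Finset.sum_congr rfl fun j _ => ?_
  ring

theorem md2_marginal_aux {p : ℕ} (Sig : Matrix (Fin p) (Fin p) ℝ) (hsym : Sig.IsSymm)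
    (x μ : Fin p → ℝ) (k : Fin p) (S : Finset (Fin p)) (hk : k ∉ S) :
    md2 Sig μ (xhat x μ (insert k S)) - md2 Sig μ (xhat x μ S)
      = (x k - μ k) * ((x k - μ k) * Sig⁻¹ k k + 2 * ∑ j ∈ S, (x j - μ j) * Sig⁻¹ j k) := by
  have hs : ∀ i j, Sig⁻¹ i j = Sig⁻¹ j i := by
    intro i j
    have h : (Sig⁻¹)ᵀ = Sig⁻¹ := by rw [Matrix.transpose_nonsing_inv, hsym.eq]
    exact congrFun (congrFun h j) i
  rw [md2_xhat_aux, md2_xhat_aux]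
  simp only [Finset.sum_insert hk, Finset.sum_add_distrib]
  have h1 : ∑ j ∈ S, (x k - μ k) * (x j - μ j) * Sig⁻¹ k j
      = (x k - μ k) * ∑ j ∈ S, (x j - μ j) * Sig⁻¹ j k := by
    rw [Finset.mul_sum]
    refine Finset.sum_congr rfl fun j _ => ?_
    rw [hs k j]; ring
  have h2 : ∑ j ∈ S, (x j - μ j) * (x k - μ k) * Sig⁻¹ j k
      = (x k - μ k) * ∑ j ∈ S, (x j - μ j) * Sig⁻¹ j k := by
    rw [Finset.mul_sum]
    refine Finset.sum_congr rfl fun j _ => ?_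
    ring
  rw [h1, h2]; ring

theorem shapley_weights_aux (n : ℕ) {α : Type*} (T : Finset α) (hT : T.card = n) :
    ∑ S ∈ T.powerset,
      ((S.card.factorial * (n + 1 - S.card - 1).factorial : ℝ) / ((n + 1).factorial : ℝ)) = 1 := by
  rw [Finset.sum_powerset_apply_card
    (fun m => ((m.factorial * (n + 1 - m - 1).factorial : ℝ) / ((n + 1).factorial : ℝ))), hT]
  have h : ∀ m ∈ Finset.range (n + 1), n.choose m •
      ((m.factorial * (n + 1 - m - 1).factorial : ℝ) / ((n + 1).factorial : ℝ))
        = 1 / ((n : ℝ) + 1) := by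
    intro m hm
    have hm' : m ≤ n := by simpa [Nat.lt_succ_iff] using hm
    have e : n + 1 - m - 1 = n - m := by omega
    have hc : (n.choose m : ℝ) * m.factorial * (n - m).factorial = n.factorial := by
      exact_mod_cast Nat.choose_mul_factorial_mul_factorial hm'
    have hn : (n.factorial : ℝ) ≠ 0 := by exact_mod_cast n.factorial_ne_zero
    have hn1 : (n : ℝ) + 1 ≠ 0 := by positivity
    rw [e, nsmul_eq_mul, ← mul_div_assoc, ← mul_assoc, hc, Nat.factorial_succ]
    push_cast
    field_simp
  rw [Finset.sum_congr rfl h, Finset.sum_const, Finset.card_range, nsmul_eq_mul]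
  push_cast
  field_simp

theorem shapley_value_formula {p : ℕ} (hp : 0 < p)
    (Sig : Matrix (Fin p) (Fin p) ℝ) (hsym : Sig.IsSymm) (hinv : IsUnit Sig.det)
    (x μ : Fin p → ℝ) (k : Fin p) :
    ∑ S ∈ ((Finset.univ : Finset (Fin p)).erase k).powerset,
        ((S.card.factorial * (p - S.card - 1).factorial : ℝ) / (p.factorial : ℝ)) *
          (md2 Sig μ (xhat x μ (insert k S)) - md2 Sig μ (xhat x μ S))
      = (x k - μ k) * ∑ j, (x j - μ j) * Sig⁻¹ j k := by
  set T := (Finset.univ : Finset (Fin p)).erase k with hTdef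
  have hT : T.card = p - 1 := by simp [hTdef]
  have hkT : k ∉ T := by simp [hTdef]
  set w : Finset (Fin p) → ℝ := fun S =>
    ((S.card.factorial * (p - S.card - 1).factorial : ℝ) / (p.factorial : ℝ)) with hw
  set m : Finset (Fin p) → ℝ := fun S =>
    md2 Sig μ (xhat x μ (insert k S)) - md2 Sig μ (xhat x μ S) with hm
  have hwsum : ∑ S ∈ T.powerset, w S = 1 := by
    obtain ⟨n, rfl⟩ : ∃ n, p = n + 1 := ⟨p - 1, by omega⟩
    exact shapley_weights_aux n T (by simpa using hT)
  have hflip : ∑ S ∈ T.powerset, w S * m S = ∑ S ∈ T.powerset, w S * m (T \ S) := by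
    refine Finset.sum_nbij' (fun S => T \ S) (fun S => T \ S) ?_ ?_ ?_ ?_ ?_
    · intro S _; simp
    · intro S _; simp
    · intro S hS; simpa using hS
    · intro S hS; simpa using hS
    · intro S hS
      have hS' : S ⊆ T := Finset.mem_powerset.1 hS
      have hle := Finset.card_le_card hS'
      have hww : w (T \ S) = w S := by
        simp only [hw]
        rw [Finset.card_sdiff_of_subset hS', hT]
        have e1 : p - (p - 1 - S.card) - 1 = S.card := by omega
        have e2 : p - S.card - 1 = p - 1 - S.card := by omega
        rw [e1, e2]; ring
      simp only [hww, Finset.sdiff_sdiff_eq_self hS']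
  have hpair : ∀ S ∈ T.powerset, w S * m S + w S * m (T \ S)
      = w S * (2 * ((x k - μ k) * ∑ j, (x j - μ j) * Sig⁻¹ j k)) := by
    intro S hS
    have hS' : S ⊆ T := Finset.mem_powerset.1 hS
    have a := md2_marginal_aux Sig hsym x μ k S (fun h => hkT (hS' h))
    have b := md2_marginal_aux Sig hsym x μ k (T \ S)
      (fun h => hkT (Finset.mem_sdiff.1 h).1)
    have c := Finset.sum_sdiff hS' (f := fun j => (x j - μ j) * Sig⁻¹ j k)
    have d := Finset.add_sum_erase Finset.univ (fun j => (x j - μ j) * Sig⁻¹ j k)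
      (Finset.mem_univ k)
    simp only [hm]
    rw [a, b, ← d, ← hTdef, ← c]
    ring
  have htot := Finset.sum_congr rfl hpair
  rw [Finset.sum_add_distrib, ← Finset.sum_mul, hwsum, ← hflip] at htot
  change ∑ S ∈ T.powerset, w S * m S = _
  linarith
end

section
/- Let p be a positive integer, Σ a symmetric invertible real p×p matrix, x, μ ∈ ℝ^p, and let j, k, l ∈ P = {1,…,p} be three pairwise distinct indices. For every subset T ⊆ P \ {j,k,l}, the third-order set function derivative of the game v(S) = md²(x̂^S) vanishes: md²(x̂^{T∪{j,k,l}}) − md²(x̂^{T∪{j,k}}) − md²(x̂^{T∪{j,l}}) − md²(x̂^{T∪{k,l}}) + md²(x̂^{T∪{j}}) + md²(x̂^{T∪{k}}) + md²(x̂^{T∪{l}}) − md²(x̂^T) = 0. -/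
open Matrix Finset

theorem xhat_insert_sub {p : ℕ} (x μ : Fin p → ℝ) (a : Fin p) (S : Finset (Fin p))
    (ha : a ∉ S) :
    xhat x μ (insert a S) - μ = (xhat x μ S - μ) + Pi.single a (x a - μ a) := by
  funext i
  by_cases h : i = a
  · subst h
    simp [xhat, ha]
  · simp [xhat, h]

theorem third_order_derivative_vanishes {p : ℕ} (hp : 0 < p)
    (Sig : Matrix (Fin p) (Fin p) ℝ) (hsym : Sig.IsSymm) (hinv : IsUnit Sig.det)
    (x μ : Fin p → ℝ) (j k l : Fin p)
    (hjk : j ≠ k) (hjl : j ≠ l) (hkl : k ≠ l)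
    (T : Finset (Fin p)) (hTj : j ∉ T) (hTk : k ∉ T) (hTl : l ∉ T) :
    md2 Sig μ (xhat x μ (insert j (insert k (insert l T))))
      - md2 Sig μ (xhat x μ (insert j (insert k T)))
      - md2 Sig μ (xhat x μ (insert j (insert l T)))
      - md2 Sig μ (xhat x μ (insert k (insert l T)))
      + md2 Sig μ (xhat x μ (insert j T))
      + md2 Sig μ (xhat x μ (insert k T))
      + md2 Sig μ (xhat x μ (insert l T))
      - md2 Sig μ (xhat x μ T) = 0 := by
  unfold md2
  rw [xhat_insert_sub x μ j (insert k (insert l T)) (by simp [*]),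
    xhat_insert_sub x μ j (insert k T) (by simp [*]),
    xhat_insert_sub x μ j (insert l T) (by simp [*]),
    xhat_insert_sub x μ k (insert l T) (by simp [*]),
    xhat_insert_sub x μ j T hTj, xhat_insert_sub x μ k T hTk, xhat_insert_sub x μ l T hTl]
  generalize xhat x μ T - μ = t
  generalize (Pi.single j (x j - μ j) : Fin p → ℝ) = a
  generalize (Pi.single k (x k - μ k) : Fin p → ℝ) = b
  generalize (Pi.single l (x l - μ l) : Fin p → ℝ) = c
  simp only [Matrix.mulVec_add, add_dotProduct, dotProduct_add]
  ring
end
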